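/- There is no biquadratic polynomial h(x,y) with complex coefficients satisfying δ_y(h) = x (the polynomial x) and δ_x(h) = 0 (the zero polynomial). -/

import Mathlib

open MvPolynomial

/-- `δ_{x_i}(h) = h_{x_i}^2 - 2 h h_{x_i x_i}` for a polynomial of two variables
(`x` is the variable indexed `0`, `y` the one indexed `1`). -/
noncomputable def ds (i : Fin 2) (h : MvPolynomial (Fin 2) ℂ) : MvPolynomial (Fin 2) ℂ :=
  (pderiv i h) ^ 2 - 2 * h * pderiv i (pderiv i h)

/-- A polynomial in two variables of degree at most `2` in each is determined by nine
coefficients. -/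
theorem exists_biquadratic_coeffs {R : Type*} [CommSemiring R] (h : MvPolynomial (Fin 2) R)
    (hd : ∀ i, h.degreeOf i ≤ 2) :
    ∃ m : ℕ → ℕ → R, h = ∑ i ∈ Finset.range 3, ∑ j ∈ Finset.range 3,
      C (m i j) * X 0 ^ i * X 1 ^ j := by
  classical
  let e : ℕ × ℕ → (Fin 2 →₀ ℕ) := fun p => Finsupp.single 0 p.1 + Finsupp.single 1 p.2
  have he0 : ∀ p, e p 0 = p.1 := fun p => by simp [e]
  have he1 : ∀ p, e p 1 = p.2 := fun p => by simp [e]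
  have hinj : Function.Injective e := fun p q hpq =>
    Prod.ext (by rw [← he0 p, hpq, he0]) (by rw [← he1 p, hpq, he1])
  have hsub : h.support ⊆ (Finset.range 3 ×ˢ Finset.range 3).image e := by
    intro s hs
    have h0 := (degreeOf_le_iff.mp (hd 0)) s hs
    have h1 := (degreeOf_le_iff.mp (hd 1)) s hs
    refine Finset.mem_image.mpr ⟨(s 0, s 1), ?_, ?_⟩
    · simp only [Finset.mem_product, Finset.mem_range]
      omega
    · ext i
      fin_cases i
      · exact he0 _
      · exact he1 _
  refine ⟨fun i j => h.coeff (e (i, j)), ?_⟩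
  conv_lhs => rw [h.as_sum]
  rw [Finset.sum_subset hsub fun s _ hs => by rw [notMem_support_iff.mp hs, monomial_zero],
    Finset.sum_image hinj.injOn, Finset.sum_product]
  refine Finset.sum_congr rfl fun i _ => Finset.sum_congr rfl fun j _ => ?_
  rw [monomial_eq, Finsupp.prod_fintype _ _ (fun _ => pow_zero _), Fin.prod_univ_two, he0, he1,
    mul_assoc]

/-- A binary quadratic form over `ℂ` with vanishing discriminant is the square of a linear form. -/
theorem exists_sq_of_discrim_eq_zero {a b c : ℂ} (h : b ^ 2 = 4 * a * c) :
    ∃ p q : ℂ, a = p ^ 2 ∧ b = 2 * p * q ∧ c = q ^ 2 := by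
  obtain ⟨p, rfl⟩ := IsAlgClosed.exists_pow_nat_eq a two_pos
  obtain ⟨q, rfl⟩ := IsAlgClosed.exists_pow_nat_eq c two_pos
  have h' : b ^ 2 = (2 * p * q) ^ 2 := by rw [h]; ring
  rcases sq_eq_sq_iff_eq_or_eq_neg.mp h' with hb | hb
  · exact ⟨p, q, rfl, hb, rfl⟩
  · exact ⟨p, -q, rfl, by rw [hb]; ring, by ring⟩

/-- If two quadratic functions over `ℂ` have equal squares, they agree up to a sign. -/
theorem quadratic_eq_or_eq_neg_of_sq_eq {a b c a' b' c' : ℂ}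
    (h : ∀ y : ℂ, (a + b * y + c * y ^ 2) ^ 2 = (a' + b' * y + c' * y ^ 2) ^ 2) :
    (∀ y : ℂ, a + b * y + c * y ^ 2 = a' + b' * y + c' * y ^ 2) ∨
      ∀ y : ℂ, a + b * y + c * y ^ 2 = -(a' + b' * y + c' * y ^ 2) := by
  let P : ℂ → ℂ → ℂ → Polynomial ℂ := fun a b c =>
    Polynomial.C a + Polynomial.C b * Polynomial.X + Polynomial.C c * Polynomial.X ^ 2
  have hP : P a b c ^ 2 = P a' b' c' ^ 2 := Polynomial.funext fun y => by simpa [P] using h y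
  refine (sq_eq_sq_iff_eq_or_eq_neg.mp hP).imp (fun H y => ?_) fun H y => ?_
  · simpa [P] using congrArg (Polynomial.eval y) H
  · have := congrArg (Polynomial.eval y) H
    rw [Polynomial.eval_neg] at this
    simpa only [P, Polynomial.eval_add, Polynomial.eval_mul, Polynomial.eval_pow,
      Polynomial.eval_C, Polynomial.eval_X] using this

/-- There is no biquadratic polynomial `h(x,y)` with `δ_y(h) = x` and `δ_x(h) = 0`. -/
theorem statement16 :
    ¬ ∃ h : MvPolynomial (Fin 2) ℂ,
        (∀ i, h.degreeOf i ≤ 2) ∧ ds 1 h = X 0 ∧ ds 0 h = 0 := by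
  rintro ⟨h, hd, h1, h0⟩
  obtain ⟨m, rfl⟩ := exists_biquadratic_coeffs h hd
  have hy : ∀ x : ℂ, (m 0 1 + m 1 1 * x + m 2 1 * x ^ 2) ^ 2 -
      4 * (m 0 0 + m 1 0 * x + m 2 0 * x ^ 2) * (m 0 2 + m 1 2 * x + m 2 2 * x ^ 2) = x := by
    intro x
    have := congrArg (eval ![x, 0]) h1
    simp [ds, Finset.sum_range_succ, pderiv_X] at this
    linear_combination this
  have hx : ∀ y : ℂ, (m 1 0 + m 1 1 * y + m 1 2 * y ^ 2) ^ 2 =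
      4 * (m 0 0 + m 0 1 * y + m 0 2 * y ^ 2) * (m 2 0 + m 2 1 * y + m 2 2 * y ^ 2) := by
    intro y
    have := congrArg (eval ![0, y]) h0
    simp [ds, Finset.sum_range_succ, pderiv_X] at this
    linear_combination this
  obtain ⟨p, q, hp, hpq, hq⟩ : ∃ p q, m 0 0 = p ^ 2 ∧ m 0 1 = 2 * p * q ∧ m 0 2 = q ^ 2 :=
    exists_sq_of_discrim_eq_zero (by linear_combination hy 0)
  obtain ⟨r, s, hr, hrs, hs⟩ : ∃ r s, m 2 0 = r ^ 2 ∧ m 2 1 = 2 * r * s ∧ m 2 2 = s ^ 2 :=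
    exists_sq_of_discrim_eq_zero (by
      linear_combination (hy 2 + hy (-2) - 4 * hy 1 - 4 * hy (-1) + 6 * hy 0) / 24)
  rw [hp, hpq, hq, hr, hrs, hs] at hx hy
  have key := quadratic_eq_or_eq_neg_of_sq_eq (a' := 2 * p * r) (b' := 2 * (p * s + q * r))
    (c' := 2 * q * s) fun y => (hx y).trans (by ring)
  have h11 := hy 1
  rcases key with key | key
  · have e0 : m 1 0 = 2 * p * r := by linear_combination key 0
    have e1 : m 1 1 = 2 * (p * s + q * r) := by linear_combination (key 1 - key (-1)) / 2
    have e2 : m 1 2 = 2 * q * s := by linear_combination (key 1 + key (-1)) / 2 - key 0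
    rw [e0, e1, e2] at h11
    exact one_ne_zero (by linear_combination -h11 : (1 : ℂ) = 0)
  · have e0 : m 1 0 = -(2 * p * r) := by linear_combination key 0
    have e1 : m 1 1 = -(2 * (p * s + q * r)) := by linear_combination (key 1 - key (-1)) / 2
    have e2 : m 1 2 = -(2 * q * s) := by linear_combination (key 1 + key (-1)) / 2 - key 0
    rw [e0, e1, e2] at h11
    exact one_ne_zero (by linear_combination -h11 : (1 : ℂ) = 0)
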